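/- Let $C_{10}\subseteq\mathbb{R}^6$ be the cone generated by the ten vectors $z_1=(0,1,0,0,0,0)$, $z_2=(0,0,1,0,0,0)$, $z_3=(0,0,0,1,0,0)$, $z_4=(0,0,0,0,1,0)$, $z_5=(0,0,0,0,0,1)$, $z_6=(1,0,2,1,1,2)$, $z_7=(1,2,0,2,1,1)$, $z_8=(1,1,2,0,2,1)$, $z_9=(1,1,1,2,0,2)$, $z_{10}=(1,2,1,1,2,0)$. Then $C_{10}$ is a pointed full-dimensional rational cone and the Hilbert basis of $C_{10}$ is exactly $\{z_1,\dots,z_{10}\}$; in particular, the additive monoid $C_{10}\cap\mathbb{Z}^6$ is generated by $z_1,\dots,z_{10}$. -/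

import Mathlib

/-- The real vector corresponding to an integer vector. -/
def toR {d : ℕ} (x : Fin d → ℤ) : Fin d → ℝ := fun i => (x i : ℝ)

/-- The cone generated by a finite family of integer vectors. -/
def coneFin {d n : ℕ} (v : Fin n → (Fin d → ℤ)) : Set (Fin d → ℝ) :=
  { y | ∃ a : Fin n → ℝ, (∀ i, 0 ≤ a i) ∧ y = ∑ i, a i • toR (v i) }

/-- The cone generated by a set of integer vectors (nonnegative real combinations
of finitely many of its elements). -/
def coneSet {d : ℕ} (B : Set (Fin d → ℤ)) : Set (Fin d → ℝ) :=
  { y | ∃ (n : ℕ) (v : Fin n → (Fin d → ℤ)) (a : Fin n → ℝ),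
      (∀ i, v i ∈ B) ∧ (∀ i, 0 ≤ a i) ∧ y = ∑ i, a i • toR (v i) }

/-- A finitely generated rational cone. -/
def IsRatCone {d : ℕ} (C : Set (Fin d → ℝ)) : Prop :=
  ∃ B : Finset (Fin d → ℤ), C = coneSet (B : Set (Fin d → ℤ))

/-- A pointed cone: `x, -x ∈ C` implies `x = 0`. -/
def PointedSet {d : ℕ} (C : Set (Fin d → ℝ)) : Prop :=
  ∀ x ∈ C, -x ∈ C → x = 0

/-- A full-dimensional subset of `ℝ^d`. -/
def FullDim {d : ℕ} (C : Set (Fin d → ℝ)) : Prop :=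
  Submodule.span ℝ C = ⊤

/-- The Hilbert basis of the monoid `C ∩ ℤ^d`: the nonzero lattice points of `C`
admitting no decomposition into two nonzero lattice points of `C`. -/
def hilbC {d : ℕ} (C : Set (Fin d → ℝ)) : Set (Fin d → ℤ) :=
  { z | toR z ∈ C ∧ z ≠ 0 ∧
    ¬∃ u v : Fin d → ℤ, toR u ∈ C ∧ toR v ∈ C ∧ u ≠ 0 ∧ v ≠ 0 ∧ z = u + v }

/-- The ten generators of the cone `C₁₀`. -/
def z : Fin 10 → (Fin 6 → ℤ) :=
  ![![0, 1, 0, 0, 0, 0],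
    ![0, 0, 1, 0, 0, 0],
    ![0, 0, 0, 1, 0, 0],
    ![0, 0, 0, 0, 1, 0],
    ![0, 0, 0, 0, 0, 1],
    ![1, 0, 2, 1, 1, 2],
    ![1, 2, 0, 2, 1, 1],
    ![1, 1, 2, 0, 2, 1],
    ![1, 1, 1, 2, 0, 2],
    ![1, 2, 1, 1, 2, 0]]

/-- The inequalities, up to a common summand, stating that a nonnegative combination of the
last five generators of `C₁₀` with coefficients `b` is bounded by a given vector in the last five
coordinates. -/
def CyclicLE {R : Type*} [Add R] [LE R] (b w : Fin 5 → R) : Prop :=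
  ∀ i, b (i - 1) + b (i + 1) ≤ w i + b i

instance (b w : Fin 5 → ℕ) : Decidable (CyclicLE b w) :=
  inferInstanceAs (Decidable (∀ _, _))

/-- Cyclic shift of a vector indexed by `Fin 5`. -/
def shift {R : Type*} (c : Fin 5 → R) (s : Fin 5) : Fin 5 → R := fun i => c (i + s)

lemma sum_shift (c : Fin 5 → ℕ) (s : Fin 5) : ∑ i, shift c s i = ∑ i, c i :=
  Equiv.sum_comp (Equiv.addRight s) c

lemma exists_shift_of_sum_one : ∀ w : Fin 5 → Fin 3,
    (∀ i, ¬ (w i = 0 ∧ w (i + 1) = 0 ∧ w (i + 2) = 0)) →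
    ∃ s, CyclicLE (shift ![1, 0, 0, 0, 0] s) (fun i => (w i : ℕ)) := by
  decide +kernel

lemma exists_shift_of_sum_two : ∀ w : Fin 5 → Fin 3,
    (∀ i, ¬ (w i = 0 ∧ w (i + 1) = 0 ∧ w (i + 2) = 0)) →
    ∃ s, CyclicLE (shift ![1, 1, 0, 0, 0] s) (fun i => (w i : ℕ)) := by
  decide +kernel

lemma exists_shift_of_sum_three : ∀ w : Fin 5 → Fin 3,
    (∀ i, ¬ (w i = 0 ∧ w (i + 1) = 0 ∧ w (i + 2) ≤ 1)) →
    (∀ i, ¬ (w i ≤ 1 ∧ w (i + 1) = 0 ∧ w (i + 2) = 0)) →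
    ∃ s, CyclicLE (shift ![1, 1, 1, 0, 0] s) (fun i => (w i : ℕ)) ∨
      CyclicLE (shift ![1, 1, 0, 1, 0] s) (fun i => (w i : ℕ)) := by
  decide +kernel

lemma exists_shift_of_sum_four : ∀ w : Fin 5 → Fin 3,
    (∀ i, ¬ (w i = 0 ∧ w (i + 1) = 0 ∧ w (i + 2) ≤ 1)) →
    (∀ i, ¬ (w i ≤ 1 ∧ w (i + 1) = 0 ∧ w (i + 2) = 0)) →
    (∀ i, ¬ (w i = 0 ∧ w (i + 1) ≤ 1 ∧ w (i + 2) = 0)) →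
    ∃ s, CyclicLE (shift ![2, 1, 0, 0, 1] s) (fun i => (w i : ℕ)) ∨
      CyclicLE (shift ![2, 2, 0, 0, 0] s) (fun i => (w i : ℕ)) ∨
      CyclicLE (shift ![1, 1, 1, 1, 0] s) (fun i => (w i : ℕ)) := by
  decide +kernel

lemma fin_five_neg_one : (-1 : Fin 5) = 4 := rfl

section Rounding

variable {b : Fin 5 → ℝ} {w : Fin 5 → ℤ}

lemma CyclicLE.three_consecutive (hw : CyclicLE b (fun i => (w i : ℝ))) (i : Fin 5) :
    b (i - 1) + b (i + 1) ≤ w i + b i ∧ b i + b (i + 2) ≤ w (i + 1) + b (i + 1) ∧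
      b (i + 1) + b (i + 3) ≤ w (i + 2) + b (i + 2) ∧
      ∑ j, b j = b (i - 1) + b i + b (i + 1) + b (i + 2) + b (i + 3) := by
  refine ⟨hw i, ?_, ?_, ?_⟩
  · convert hw (i + 1) using 3 <;> grind
  · convert hw (i + 2) using 3 <;> grind
  · rw [Fin.sum_univ_five]
    fin_cases i <;> simp [fin_five_neg_one] <;> ring

lemma CyclicLE.not_zero_zero_zero (h1 : ∀ i, b i < 1)
    (hw : CyclicLE b (fun i => (w i : ℝ))) (hs : 1 ≤ ∑ i, b i) (i : Fin 5) :
    ¬ (w i ≤ 0 ∧ w (i + 1) ≤ 0 ∧ w (i + 2) ≤ 0) := by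
  rintro ⟨ha, hb, hc⟩
  obtain ⟨h, h', h'', e⟩ := hw.three_consecutive i
  rify at ha hb hc
  linarith [h1 (i + 1)]

lemma CyclicLE.not_zero_zero_one (h1 : ∀ i, b i < 1)
    (hw : CyclicLE b (fun i => (w i : ℝ))) (hs : 3 ≤ ∑ i, b i) (i : Fin 5) :
    ¬ (w i ≤ 0 ∧ w (i + 1) ≤ 0 ∧ w (i + 2) ≤ 1) := by
  rintro ⟨ha, hb, -⟩
  obtain ⟨h, h', h'', e⟩ := hw.three_consecutive i
  rify at ha hb
  linarith [h1 (i + 1), h1 i, h1 (i + 3)]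

lemma CyclicLE.not_one_zero_zero (h1 : ∀ i, b i < 1)
    (hw : CyclicLE b (fun i => (w i : ℝ))) (hs : 3 ≤ ∑ i, b i) (i : Fin 5) :
    ¬ (w i ≤ 1 ∧ w (i + 1) ≤ 0 ∧ w (i + 2) ≤ 0) := by
  rintro ⟨-, hb, hc⟩
  obtain ⟨h, h', h'', e⟩ := hw.three_consecutive i
  rify at hb hc
  linarith [h1 (i + 1), h1 (i + 2), h1 (i - 1)]

lemma CyclicLE.not_zero_one_zero (h1 : ∀ i, b i < 1)
    (hw : CyclicLE b (fun i => (w i : ℝ))) (hs : 4 ≤ ∑ i, b i) (i : Fin 5) :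
    ¬ (w i ≤ 0 ∧ w (i + 1) ≤ 1 ∧ w (i + 2) ≤ 0) := by
  rintro ⟨ha, hb, hc⟩
  obtain ⟨h, h', h'', e⟩ := hw.three_consecutive i
  rify at ha hb hc
  linarith [h1 i, h1 (i + 2)]

lemma exists_nat_cyclicLE_of_lt_one (h1 : ∀ i, b i < 1) (h0 : ∀ i, 0 ≤ b i)
    (hw : CyclicLE b (fun i => (w i : ℝ))) {k : ℕ} (hk : ∑ i, b i = k) :
    ∃ c : Fin 5 → ℕ, ∑ i, c i = k ∧ CyclicLE (fun i => (c i : ℤ)) w := by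
  have hw0 (i) : 0 ≤ w i := by
    have : (-1 : ℝ) < w i := by linarith [hw i, h1 i, h0 (i - 1), h0 (i + 1)]
    have : -1 < w i := by exact_mod_cast this
    omega
  have hk5 : k < 5 := by
    have : (k : ℝ) < 5 := by
      rw [← hk, Fin.sum_univ_five]
      linarith [h1 0, h1 1, h1 2, h1 3, h1 4]
    exact_mod_cast this
  let v : Fin 5 → Fin 3 := fun i => ⟨min (w i).toNat 2, by omega⟩
  have hv0 (i) : v i = 0 → w i ≤ 0 := by
    simp only [v, Fin.ext_iff, Fin.val_zero]
    omega
  have hv1 (i) : v i ≤ 1 → w i ≤ 1 := by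
    simp only [v, Fin.le_def, Fin.val_one]
    omega
  have of_shift (c : Fin 5 → ℕ) (s : Fin 5) (hc : ∑ i, c i = k)
      (h : CyclicLE (shift c s) (fun i => (v i : ℕ))) :
      ∃ c : Fin 5 → ℕ, ∑ i, c i = k ∧ CyclicLE (fun i => (c i : ℤ)) w := by
    refine ⟨shift c s, (sum_shift c s).trans hc, fun i => ?_⟩
    have := h i
    have := hw0 i
    simp only [v] at *
    omega
  have z000 (hs : 1 ≤ k) (i : Fin 5) : ¬ (v i = 0 ∧ v (i + 1) = 0 ∧ v (i + 2) = 0) :=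
    fun h => hw.not_zero_zero_zero h1 (by rw [hk]; exact_mod_cast hs) i
      ⟨hv0 _ h.1, hv0 _ h.2.1, hv0 _ h.2.2⟩
  have z001 (hs : 3 ≤ k) (i : Fin 5) : ¬ (v i = 0 ∧ v (i + 1) = 0 ∧ v (i + 2) ≤ 1) :=
    fun h => hw.not_zero_zero_one h1 (by rw [hk]; exact_mod_cast hs) i
      ⟨hv0 _ h.1, hv0 _ h.2.1, hv1 _ h.2.2⟩
  have z100 (hs : 3 ≤ k) (i : Fin 5) : ¬ (v i ≤ 1 ∧ v (i + 1) = 0 ∧ v (i + 2) = 0) :=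
    fun h => hw.not_one_zero_zero h1 (by rw [hk]; exact_mod_cast hs) i
      ⟨hv1 _ h.1, hv0 _ h.2.1, hv0 _ h.2.2⟩
  have z010 (hs : 4 ≤ k) (i : Fin 5) : ¬ (v i = 0 ∧ v (i + 1) ≤ 1 ∧ v (i + 2) = 0) :=
    fun h => hw.not_zero_one_zero h1 (by rw [hk]; exact_mod_cast hs) i
      ⟨hv0 _ h.1, hv1 _ h.2.1, hv0 _ h.2.2⟩
  interval_cases k
  · exact ⟨0, by simp, fun i => by simpa using hw0 i⟩
  · obtain ⟨s, h⟩ := exists_shift_of_sum_one v (z000 le_rfl)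
    exact of_shift _ s (by decide) h
  · obtain ⟨s, h⟩ := exists_shift_of_sum_two v (z000 (by norm_num))
    exact of_shift _ s (by decide) h
  · obtain ⟨s, h | h⟩ := exists_shift_of_sum_three v (z001 le_rfl) (z100 le_rfl)
    all_goals exact of_shift _ s (by decide) h
  · obtain ⟨s, h | h | h⟩ := exists_shift_of_sum_four v (z001 (by norm_num)) (z100 (by norm_num))
      (z010 le_rfl)
    all_goals exact of_shift _ s (by decide) h

lemma exists_nat_cyclicLE (h0 : ∀ i, 0 ≤ b i)
    (hw : CyclicLE b (fun i => (w i : ℝ))) {k : ℤ} (hk : ∑ i, b i = k) :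
    ∃ c : Fin 5 → ℕ, ∑ i, (c i : ℤ) = k ∧ CyclicLE (fun i => (c i : ℤ)) w := by
  have hsum : ∑ i, Int.fract (b i) = ((k - ∑ i, ⌊b i⌋ : ℤ) : ℝ) := by
    push_cast
    rw [← hk, ← Finset.sum_sub_distrib]
    rfl
  have hnonneg : 0 ≤ k - ∑ i, ⌊b i⌋ := by
    have : (0 : ℝ) ≤ ((k - ∑ i, ⌊b i⌋ : ℤ) : ℝ) :=
      hsum ▸ Finset.sum_nonneg fun i _ => Int.fract_nonneg _
    exact_mod_cast this
  obtain ⟨m, hm⟩ := Int.eq_ofNat_of_zero_le hnonneg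
  obtain ⟨c, hc, hcw⟩ := exists_nat_cyclicLE_of_lt_one (b := fun i => Int.fract (b i))
    (w := fun i => w i + ⌊b i⌋ - ⌊b (i - 1)⌋ - ⌊b (i + 1)⌋)
    (fun i => Int.fract_lt_one _) (fun i => Int.fract_nonneg _)
    (fun i => by
      have := hw i
      simp only [Int.fract]
      push_cast
      linarith) (k := m) (by rw [hsum, hm]; simp)
  have hfl (i) : ((⌊b i⌋.toNat : ℕ) : ℤ) = ⌊b i⌋ := Int.toNat_of_nonneg (Int.floor_nonneg.2 (h0 i))
  refine ⟨fun i => c i + ⌊b i⌋.toNat, ?_, fun i => ?_⟩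
  · simp only [Nat.cast_add, hfl, Finset.sum_add_distrib]
    rw [← Nat.cast_sum, hc]
    linarith
  · have := hcw i
    simp only [Nat.cast_add, hfl]
    simp only at this
    linarith

end Rounding

lemma coneFin_z_coords {y : Fin 6 → ℝ} (hy : y ∈ coneFin z) :
    ∃ b : Fin 5 → ℝ, (∀ i, 0 ≤ b i) ∧ ∑ i, b i = y 0 ∧
      CyclicLE b (fun i => y i.succ - y 0) := by
  obtain ⟨a, ha, rfl⟩ := hy
  refine ⟨![a 5, a 6, a 7, a 8, a 9], fun i => ?_, ?_, fun i => ?_⟩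
  · fin_cases i <;> exact ha _
  · simp [Fin.sum_univ_succ, toR, z]
  · fin_cases i <;> simp [Fin.sum_univ_succ, toR, z, fin_five_neg_one]
    all_goals linarith [ha 0, ha 1, ha 2, ha 3, ha 4]

lemma toR_zero {d : ℕ} : toR (0 : Fin d → ℤ) = 0 := by
  ext i; simp [toR]

lemma toR_add {d : ℕ} (x y : Fin d → ℤ) : toR (x + y) = toR x + toR y := by
  ext i; simp [toR]

lemma toR_mem_coneFin {d n : ℕ} (v : Fin n → Fin d → ℤ) (i : Fin n) : toR (v i) ∈ coneFin v :=
  ⟨Pi.single i 1, (Pi.single_nonneg.2 zero_le_one : (0 : Fin n → ℝ) ≤ Pi.single i 1), by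
    simp [Pi.single_apply]⟩

lemma toR_mem_coneFin_of_mem_closure {d n : ℕ} {v : Fin n → Fin d → ℤ} {x : Fin d → ℤ}
    (hx : x ∈ AddSubmonoid.closure (Set.range v)) : toR x ∈ coneFin v := by
  induction hx using AddSubmonoid.closure_induction with
  | mem x hx =>
    obtain ⟨i, rfl⟩ := hx
    exact toR_mem_coneFin v i
  | zero => exact ⟨0, by simp, by simp [toR_zero]⟩
  | add x y _ _ hx hy =>
    obtain ⟨a, ha, hxa⟩ := hx
    obtain ⟨b, hb, hyb⟩ := hy
    exact ⟨a + b, fun i => add_nonneg (ha i) (hb i), by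
      simp [toR_add, hxa, hyb, add_smul, Finset.sum_add_distrib]⟩

lemma mem_closure_range_z {x : Fin 6 → ℤ} (hx : toR x ∈ coneFin z) :
    x ∈ AddSubmonoid.closure (Set.range z) := by
  obtain ⟨b, h0, hk, hb⟩ := coneFin_z_coords hx
  obtain ⟨c, hc, hcw⟩ := exists_nat_cyclicLE (w := fun i => x i.succ - x 0) (k := x 0) h0
    (by simpa [toR] using hb) (by simpa [toR] using hk)
  have hm (i) : ∃ m : ℕ, (m : ℤ) = x i.succ - x 0 + c i - c (i - 1) - c (i + 1) :=
    ⟨_, Int.toNat_of_nonneg (by linarith [hcw i])⟩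
  choose m hm using hm
  have hx' : x = ∑ i,
      (![m 0, m 1, m 2, m 3, m 4, c 0, c 1, c 2, c 3, c 4] : Fin 10 → ℕ) i • z i := by
    rw [Fin.sum_univ_five] at hc
    have e0 := hm 0
    have e1 := hm 1
    have e2 := hm 2
    have e3 := hm 3
    have e4 := hm 4
    simp [fin_five_neg_one] at e0 e1 e2 e3 e4
    ext i
    fin_cases i <;> simp [Fin.sum_univ_succ, z] <;> linarith
  rw [hx']
  exact AddSubmonoid.sum_mem _ fun i _ =>
    AddSubmonoid.nsmul_mem _ (AddSubmonoid.subset_closure (Set.mem_range_self i)) _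

lemma coneFin_z_nonneg {y : Fin 6 → ℝ} (hy : y ∈ coneFin z) (i : Fin 6) : 0 ≤ y i := by
  obtain ⟨a, ha, rfl⟩ := hy
  rw [Finset.sum_apply]
  refine Finset.sum_nonneg fun j _ => mul_nonneg (ha j) ?_
  have : ∀ j i, 0 ≤ z j i := by decide
  exact Int.cast_nonneg (this j i)

lemma six_mul_le_of_mem_coneFin_z {x : Fin 6 → ℤ} (hx : toR x ∈ coneFin z) :
    6 * x 0 ≤ x 1 + x 2 + x 3 + x 4 + x 5 := by
  obtain ⟨b, h0, hk, hb⟩ := coneFin_z_coords hx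
  rw [Fin.sum_univ_five] at hk
  have e0 := hb 0
  have e1 := hb 1
  have e2 := hb 2
  have e3 := hb 3
  have e4 := hb 4
  simp [toR, fin_five_neg_one] at e0 e1 e2 e3 e4 hk
  rify
  linarith

lemma pointedSet_coneFin_z : PointedSet (coneFin z) := fun x hx hx' => by
  ext i
  have h := coneFin_z_nonneg hx i
  have h' := coneFin_z_nonneg hx' i
  simp only [Pi.neg_apply, Pi.zero_apply] at *
  linarith

lemma fullDim_coneFin_z : FullDim (coneFin z) := by
  refine eq_top_iff.2 fun v _ => ?_
  have hv : v = ∑ i, (![v 1, v 2 - 2 * v 0, v 3 - v 0, v 4 - v 0, v 5 - 2 * v 0, v 0,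
      0, 0, 0, 0] : Fin 10 → ℝ) i • toR (z i) := by
    ext i
    fin_cases i <;> simp [Fin.sum_univ_succ, toR, z] <;> ring
  rw [hv]
  exact Submodule.sum_mem _ fun i _ =>
    Submodule.smul_mem _ _ (Submodule.subset_span (toR_mem_coneFin z i))

lemma z_indecomposable (i : Fin 10) {u v : Fin 6 → ℤ} (hu : toR u ∈ coneFin z)
    (hv : toR v ∈ coneFin z) (h : z i = u + v) : u = 0 ∨ v = 0 := by
  have hz : z i 0 = 0 ∧ z i 1 + z i 2 + z i 3 + z i 4 + z i 5 = 1 ∨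
      z i 0 = 1 ∧ z i 1 + z i 2 + z i 3 + z i 4 + z i 5 = 6 := by
    clear h
    revert i; decide
  have hu0 (j) : 0 ≤ u j := Int.cast_nonneg_iff.1 (coneFin_z_nonneg hu j)
  have hv0 (j) : 0 ≤ v j := Int.cast_nonneg_iff.1 (coneFin_z_nonneg hv j)
  have hu6 : 6 * u 0 ≤ u 1 + u 2 + u 3 + u 4 + u 5 :=
    six_mul_le_of_mem_coneFin_z hu
  have hv6 : 6 * v 0 ≤ v 1 + v 2 + v 3 + v 4 + v 5 :=
    six_mul_le_of_mem_coneFin_z hv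
  simp only [h, Pi.add_apply] at hz
  simp only [funext_iff, Fin.forall_fin_succ, Pi.zero_apply] at *
  simp at *
  omega

lemma z_ne_zero : ∀ i, z i ≠ 0 := by
  decide

lemma hilbC_coneFin_z : hilbC (coneFin z) = Set.range z := by
  ext x
  constructor
  · rintro ⟨hx, hx0, hdec⟩
    have hmem := mem_closure_range_z hx
    induction hmem using AddSubmonoid.closure_induction_left with
    | zero => exact absurd rfl hx0
    | add_left y hy w hw _ =>
      by_cases hw0 : w = 0
      · simpa [hw0] using hy
      · obtain ⟨i, rfl⟩ := hy
        refine absurd ⟨z i, w, toR_mem_coneFin z i, toR_mem_coneFin_of_mem_closure hw, z_ne_zero i,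
          hw0, rfl⟩ hdec
  · rintro ⟨i, rfl⟩
    refine ⟨toR_mem_coneFin z i, z_ne_zero i, ?_⟩
    rintro ⟨u, v, hu, hv, hu0, hv0, h⟩
    exact (z_indecomposable i hu hv h).elim hu0 hv0

/-- `C₁₀` is a pointed full-dimensional rational cone, its Hilbert basis is
exactly `{z₁, …, z₁₀}`, and the monoid `C₁₀ ∩ ℤ⁶` is generated by
`z₁, …, z₁₀`. -/
theorem C10_hilbert_basis :
    PointedSet (coneFin z) ∧ FullDim (coneFin z) ∧
    hilbC (coneFin z) = Set.range z ∧
    ∀ x : Fin 6 → ℤ, toR x ∈ coneFin z ↔ x ∈ AddSubmonoid.closure (Set.range z) := by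
  exact ⟨pointedSet_coneFin_z, fullDim_coneFin_z, hilbC_coneFin_z,
    fun _ => ⟨mem_closure_range_z, toR_mem_coneFin_of_mem_closure⟩⟩
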